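/- Let Γ be a finite connected non-complete graph of prime valency p that is 2-geodesic transitive but not 2-arc transitive. Then Γ is a non-bipartite antipodal double cover of the complete graph K_{p+1}: Γ is not bipartite, the relation 'at distance 3' partitions the vertex set into p+1 fibres of size 2, any two vertices in distinct fibres are joined by exactly one edge between each vertex of one fibre and the two vertices of the other (each vertex of one fibre is adjacent to exactly one vertex of the other fibre), and the quotient graph on fibres is the complete graph K_{p+1}. -/

import Mathlib

open SimpleGraph

/-- `Γ` is arc transitive: its automorphism group is transitive on ordered pairs
of adjacent vertices. -/
def ArcTransitive {V : Type*} (Γ : SimpleGraph V) : Prop :=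
  ∀ ⦃v u v' u' : V⦄, Γ.Adj v u → Γ.Adj v' u' →
    ∃ φ : Γ ≃g Γ, φ v = v' ∧ φ u = u'

/-- `(v,u,w)` is a 2-arc of `Γ`. -/
def Is2Arc {V : Type*} (Γ : SimpleGraph V) (v u w : V) : Prop :=
  Γ.Adj v u ∧ Γ.Adj u w ∧ v ≠ w

/-- `(v,u,w)` is a 2-geodesic of `Γ`: a 2-arc with `v`, `w` non-adjacent. -/
def Is2Geodesic {V : Type*} (Γ : SimpleGraph V) (v u w : V) : Prop :=
  Γ.Adj v u ∧ Γ.Adj u w ∧ v ≠ w ∧ ¬ Γ.Adj v w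

/-- `Γ` is 2-arc transitive: arc transitive and transitive on 2-arcs. -/
def TwoArcTransitive {V : Type*} (Γ : SimpleGraph V) : Prop :=
  ArcTransitive Γ ∧
  ∀ ⦃v u w v' u' w' : V⦄, Is2Arc Γ v u w → Is2Arc Γ v' u' w' →
    ∃ φ : Γ ≃g Γ, φ v = v' ∧ φ u = u' ∧ φ w = w'

/-- `Γ` is 2-geodesic transitive: arc transitive and transitive on 2-geodesics. -/
def TwoGeodesicTransitive {V : Type*} (Γ : SimpleGraph V) : Prop :=
  ArcTransitive Γ ∧
  ∀ ⦃v u w v' u' w' : V⦄, Is2Geodesic Γ v u w → Is2Geodesic Γ v' u' w' →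
    ∃ φ : Γ ≃g Γ, φ v = v' ∧ φ u = u' ∧ φ w = w'

open scoped Pointwise Polynomial

section DiffSum

open Polynomial

/-- The operator `P ↦ ∑ u ∈ U, (P(X + u) - P(X))`. -/
noncomputable def diffSum {F : Type*} [Field F] (U : Finset F) (P : F[X]) : F[X] :=
  ∑ u ∈ U, (taylor u P - P)

lemma eval_diffSum {F : Type*} [Field F] (U : Finset F) (P : F[X]) (x : F) :
    (diffSum U P).eval x = ∑ u ∈ U, (P.eval (x + u) - P.eval x) := by
  simp [diffSum, eval_finsetSum, taylor_eval]

lemma coeff_diffSum {F : Type*} [Field F] (U : Finset F) (P : F[X]) (j : ℕ) :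
    (diffSum U P).coeff j = ∑ i ∈ Finset.Icc 1 P.natDegree,
      ((i + j).choose j : F) * P.coeff (i + j) * ∑ u ∈ U, u ^ i := by
  have h : ∀ u : F, (taylor u P - P).coeff j = ∑ i ∈ Finset.Icc 1 P.natDegree,
      ((i + j).choose j : F) * P.coeff (i + j) * u ^ i := by
    intro u
    rw [coeff_sub, taylor_coeff, eval_eq_sum_range' (n := P.natDegree + 1),
      Finset.sum_range_succ', Finset.range_eq_Ico,
      Finset.sum_Ico_add' (fun i => _ * u ^ i) 0 P.natDegree 1]
    · simp [hasseDeriv_coeff]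
      rfl
    · exact Nat.lt_succ_of_le ((natDegree_hasseDeriv_le _ _).trans (Nat.sub_le _ _))
  simp only [diffSum, finsetSum_coeff, h]
  rw [Finset.sum_comm]
  simp [Finset.mul_sum]

lemma natDegree_diffSum_le {F : Type*} [Field F] (U : Finset F) (P : F[X]) :
    (diffSum U P).natDegree ≤ P.natDegree := by
  refine natDegree_sum_le_of_forall_le _ _ fun u _ => ?_
  exact (natDegree_sub_le _ _).trans (by simp [natDegree_taylor])

lemma diffSum_eq_zero {F : Type*} [Field F] {U : Finset F} {k : ℕ}
    (hlt : ∀ i, 1 ≤ i → i < k → ∑ u ∈ U, u ^ i = 0) {P : F[X]} (hP : P.natDegree < k) :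
    diffSum U P = 0 := by
  ext j
  rw [coeff_diffSum, coeff_zero]
  refine Finset.sum_eq_zero fun i hi => ?_
  rw [Finset.mem_Icc] at hi
  rw [hlt i hi.1 (by lia), mul_zero]

lemma coeff_diffSum_ne_zero {p : ℕ} [Fact p.Prime] {U : Finset (ZMod p)} {k : ℕ} (hk1 : 1 ≤ k)
    (hlt : ∀ i, 1 ≤ i → i < k → ∑ u ∈ U, u ^ i = 0) (hk : ∑ u ∈ U, u ^ k ≠ 0)
    {P : (ZMod p)[X]} (hkP : k ≤ P.natDegree) (hP : P.natDegree < p) :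
    (diffSum U P).coeff (P.natDegree - k) ≠ 0 := by
  rw [coeff_diffSum, Finset.sum_eq_single_of_mem k (by simp; lia)]
  · have hsum : k + (P.natDegree - k) = P.natDegree := by lia
    rw [hsum]
    refine mul_ne_zero (mul_ne_zero ?_ ?_) hk
    · rw [Ne, ZMod.natCast_eq_zero_iff]
      intro h
      have hfac := Nat.choose_mul_factorial_mul_factorial (Nat.sub_le P.natDegree k)
      rw [mul_assoc] at hfac
      have hdvd := h.trans (Dvd.intro _ hfac)
      rw [(Fact.out : p.Prime).dvd_factorial] at hdvd
      lia
    · rw [coeff_natDegree, Ne, leadingCoeff_eq_zero]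
      rintro rfl
      simp at hkP
      lia
  · intro i hi hik
    rw [Finset.mem_Icc] at hi
    rcases lt_or_gt_of_ne hik with h | h
    · rw [hlt i hi.1 h, mul_zero]
    · rw [coeff_eq_zero_of_natDegree_lt (by lia)]
      simp

/-- Some power sum of exponent at most `#U` of a nonempty set `U` of nonzero elements is nonzero. -/
lemma exists_powerSum_ne_zero {F : Type*} [Field F] {U : Finset F} (hU : U.Nonempty)
    (h0 : (0 : F) ∉ U) : ∃ k, 1 ≤ k ∧ k ≤ U.card ∧ ∑ u ∈ U, u ^ k ≠ 0 := by
  classical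
  by_contra! h
  obtain ⟨a, ha⟩ := hU
  set Q : F[X] := X * ∏ u ∈ U.erase a, (X - C u) with hQ
  have hdeg : Q.natDegree < U.card + 1 := by
    have : (∏ u ∈ U.erase a, (X - C u)).natDegree = (U.erase a).card := by
      simp
    have h2 := natDegree_mul_le (p := (X : F[X])) (q := ∏ u ∈ U.erase a, (X - C u))
    rw [this, Finset.card_erase_of_mem ha, natDegree_X] at h2
    have := Finset.card_pos.2 ⟨a, ha⟩
    lia
  have h1 : ∑ u ∈ U, Q.eval u = 0 := by
    simp only [eval_eq_sum_range' hdeg]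
    rw [Finset.sum_comm]
    refine Finset.sum_eq_zero fun i hi => ?_
    rw [Finset.mem_range] at hi
    rw [← Finset.mul_sum]
    rcases Nat.eq_zero_or_pos i with rfl | hi0
    · simp [hQ]
    · rw [h i hi0 (by lia), mul_zero]
  rw [Finset.sum_eq_single_of_mem a ha] at h1
  · simp only [hQ, eval_mul, eval_X, eval_prod, eval_sub, eval_C, mul_eq_zero,
      Finset.prod_eq_zero_iff, Finset.mem_erase, sub_eq_zero] at h1
    rcases h1 with rfl | ⟨b, ⟨hb, -⟩, rfl⟩
    · exact h0 ha
    · exact hb rfl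
  · intro b hb hba
    simp only [hQ, eval_mul, eval_prod]
    rw [Finset.prod_eq_zero (i := b)] <;> simp [hb, hba]

lemma exists_mul_between {n k : ℕ} (hn : 1 < n) (hnk : n < k) :
    ∃ i, i < k ∧ k ≤ i * n ∧ i * n < 2 * k := by
  have hdm := Nat.div_add_mod k n
  have hml := Nat.mod_lt k (show n > 0 by lia)
  refine ⟨k / n + 1, ?_, ?_, ?_⟩
  · have hq : 1 ≤ k / n := (Nat.one_le_div_iff (by lia)).2 hnk.le
    by_contra! h
    have : 2 * (k / n) ≤ n * (k / n) := Nat.mul_le_mul_right _ hn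
    have : k = 2 := by lia
    lia
  · rw [add_mul, mul_comm]; lia
  · rw [add_mul, mul_comm]; lia

/-- Müller's lemma: a permutation of `ZMod p` preserving a small nonempty set of nonzero differences
is affine. -/
theorem affine_of_preserves_differences {p : ℕ} [Fact p.Prime] {U : Finset (ZMod p)}
    (hU : U.Nonempty) (h0 : (0 : ZMod p) ∉ U) (hcard : 2 * U.card + 1 ≤ p)
    (π : Equiv.Perm (ZMod p)) (hπ : ∀ x y, y - x ∈ U → π y - π x ∈ U) :
    ∃ a b, ∀ x, π x = a * x + b := by
  classical
  have hex := exists_powerSum_ne_zero hU h0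
  set k := Nat.find hex
  obtain ⟨hk1, hkU, hk⟩ : 1 ≤ k ∧ k ≤ U.card ∧ ∑ u ∈ U, u ^ k ≠ 0 := Nat.find_spec hex
  have hlt : ∀ i, 1 ≤ i → i < k → ∑ u ∈ U, u ^ i = 0 := by
    intro i hi hik
    by_contra hne
    exact Nat.find_min hex hik ⟨hi, by lia, hne⟩
  set P : (ZMod p)[X] := Lagrange.interpolate Finset.univ id π
  have hPeval : ∀ x, P.eval x = π x := fun x =>
    Lagrange.eval_interpolate_at_node (s := Finset.univ) (v := id) (i := x) π
      (Set.injOn_id _) (Finset.mem_univ _)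
  have hPdeg : P.natDegree < p := by
    by_cases hP0 : P = 0
    · rw [hP0]; simpa using (Fact.out : p.Prime).pos
    · rw [natDegree_lt_iff_degree_lt hP0]
      have h := Lagrange.degree_interpolate_lt (s := Finset.univ) (v := id) π (Set.injOn_id _)
      rwa [Finset.card_univ, ZMod.card] at h
  have hshift : ∀ (g : ZMod p → ZMod p) (x : ZMod p),
      ∑ u ∈ U, g (π (x + u)) = ∑ u ∈ U, g (π x + u) := by
    intro g x
    have hmaps : Set.MapsTo (fun u => π (x + u) - π x) U U := fun u hu => hπ _ _ (by simpa using hu)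
    have hinj : Set.InjOn (fun u => π (x + u) - π x) U := fun u _ v _ huv => by
      simpa using huv
    refine Finset.sum_bij (fun u _ => π (x + u) - π x) (fun u hu => hmaps hu)
      (fun u hu v hv huv => hinj hu hv huv) (fun v hv => ?_) (fun u hu => by simp)
    obtain ⟨u, hu, huv⟩ := Finset.surjOn_of_injOn_of_card_le _ hmaps hinj le_rfl hv
    exact ⟨u, hu, huv⟩
  have hzero : ∀ R : (ZMod p)[X], R.natDegree < p → (∀ x, R.eval x = 0) → R = 0 := by
    intro R hR h
    exact eq_zero_of_natDegree_lt_card_of_eval_eq_zero' R Finset.univ (fun x _ => h x)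
      (by simpa [ZMod.card] using hR)
  have hsum1 : ∀ x, (diffSum U P).eval x = ∑ u ∈ U, u ^ 1 := by
    intro x
    rw [eval_diffSum]
    simp only [hPeval, Finset.sum_sub_distrib]
    have := hshift id x
    simp only [id] at this
    rw [this, Finset.sum_add_distrib]
    simp
  have hn1 : P.natDegree ≤ 1 := by
    by_contra! hn
    rcases hk1.eq_or_lt with hk1' | hk1'
    · have hC : diffSum U P - C (∑ u ∈ U, u ^ 1) = 0 := by
        refine hzero _ ?_ fun x => by rw [eval_sub, eval_C, hsum1, sub_self]
        rw [natDegree_sub_C]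
        exact (natDegree_diffSum_le _ _).trans_lt hPdeg
      refine coeff_diffSum_ne_zero hk1 hlt hk (by lia) hPdeg ?_
      rw [sub_eq_zero.1 hC, coeff_C, if_neg (by lia)]
    · have key : ∀ i, i < k → (P ^ i).natDegree < p → (P ^ i).natDegree < k := by
        intro i hi hip
        by_contra! hge
        refine coeff_diffSum_ne_zero hk1 hlt hk hge hip ?_
        rw [hzero (diffSum U (P ^ i)) ((natDegree_diffSum_le _ _).trans_lt hip), coeff_zero]
        intro x
        have h2 := congrArg (eval (π x)) (diffSum_eq_zero (P := X ^ i) hlt (by simpa using hi))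
        rw [eval_diffSum] at h2 ⊢
        simp only [eval_pow, hPeval, Finset.sum_sub_distrib, eval_X, eval_zero] at h2 ⊢
        rw [hshift (fun z => z ^ i) x, h2]
      have hnk : P.natDegree < k := by simpa using key 1 hk1' (by simpa using hPdeg)
      obtain ⟨i, hik, hki, hi⟩ := exists_mul_between hn hnk
      have hlast := key i hik (by rw [natDegree_pow]; lia)
      rw [natDegree_pow] at hlast
      lia
  obtain ⟨a, b, hab⟩ := exists_eq_X_add_C_of_natDegree_le_one hn1
  exact ⟨a, b, fun x => by rw [← hPeval, hab]; simp⟩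

end DiffSum

lemma ZMod.mem_of_add_mem {p : ℕ} [Fact p.Prime] {T : Set (ZMod p)} (hT : T.Nonempty)
    {s : ZMod p} (hs : s ≠ 0) (h : ∀ x ∈ T, x + s ∈ T) (y : ZMod p) : y ∈ T := by
  obtain ⟨x, hx⟩ := hT
  have hn : ∀ n : ℕ, x + n * s ∈ T := by
    intro n
    induction n with
    | zero => simpa using hx
    | succ n ih =>
      have := h _ ih
      rwa [add_assoc, ← add_one_mul, ← Nat.cast_succ] at this
  have := hn ((y - x) / s).val
  rwa [ZMod.natCast_zmod_val, div_mul_cancel₀ _ hs, add_sub_cancel] at this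

/-- `S` and `U` partition the nonzero residues modulo `p`, and the automorphisms of the Cayley
graph of `S` which fix `0` are transitive on `U`. -/
structure IsCoarcTransitivePartition {p : ℕ} (S U : Finset (ZMod p)) : Prop where
  zero_notMem_left : 0 ∉ S
  zero_notMem_right : 0 ∉ U
  mem_left_iff : ∀ x ≠ 0, x ∈ S ↔ x ∉ U
  neg_mem_right : ∀ x ∈ U, -x ∈ U
  left_nonempty : S.Nonempty
  right_nonempty : U.Nonempty
  exists_perm : ∀ u ∈ U, ∀ u' ∈ U, ∃ π : Equiv.Perm (ZMod p),
    (∀ x y, π y - π x ∈ S ↔ y - x ∈ S) ∧ π 0 = 0 ∧ π u = u'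

namespace IsCoarcTransitivePartition

variable {p : ℕ} {S U : Finset (ZMod p)}

lemma card_add_card [Fact p.Prime] (h : IsCoarcTransitivePartition S U) :
    S.card + U.card + 1 = p := by
  have hd : Disjoint S U := Finset.disjoint_left.2 fun x hS hU =>
    (h.mem_left_iff x (by rintro rfl; exact h.zero_notMem_left hS)).1 hS hU
  have h0 : (0 : ZMod p) ∉ S ∪ U := by simp [h.zero_notMem_left, h.zero_notMem_right]
  rw [← Finset.card_union_of_disjoint hd, ← Finset.card_insert_of_notMem h0]
  have : insert 0 (S ∪ U) = Finset.univ := by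
    ext x
    have := h.mem_left_iff x
    simp only [Finset.mem_insert, Finset.mem_union, Finset.mem_univ, iff_true]
    tauto
  rw [this, Finset.card_univ, ZMod.card]

lemma exists_mul [Fact p.Prime] (h : IsCoarcTransitivePartition S U) {u u' : ZMod p}
    (hu : u ∈ U) (hu' : u' ∈ U) : ∃ a, a * u = u' ∧ ∀ x ∈ U, a * x ∈ U := by
  obtain ⟨π, hπS, hπ0, hπu⟩ := h.exists_perm u hu u' hu'
  have hπU : ∀ x y, y - x ∈ U → π y - π x ∈ U := by
    intro x y hxy
    have hne : y - x ≠ 0 := by rintro h'; exact h.zero_notMem_right (h' ▸ hxy)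
    have hne' : π y - π x ≠ 0 := by
      rw [sub_ne_zero] at hne ⊢; exact π.injective.ne hne
    by_contra h'
    rw [← h.mem_left_iff _ hne', hπS, h.mem_left_iff _ hne] at h'
    exact h' hxy
  have hcard := h.card_add_card
  obtain ⟨a, b, hab⟩ : ∃ a b, ∀ x, π x = a * x + b := by
    rcases le_total S.card U.card with hle | hle
    · exact affine_of_preserves_differences h.left_nonempty h.zero_notMem_left (by lia) π
        fun x y => (hπS x y).2
    · exact affine_of_preserves_differences h.right_nonempty h.zero_notMem_right (by lia) π hπU
  have hb : b = 0 := by simpa [hab] using hπ0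
  subst hb
  refine ⟨a, by simpa [hab] using hπu, fun x hx => ?_⟩
  simpa [hab] using hπU 0 x (by simpa using hx)

lemma card_right_dvd [Fact p.Prime] (h : IsCoarcTransitivePartition S U) : U.card ∣ p - 1 := by
  obtain ⟨u₀, hu₀⟩ := h.right_nonempty
  have hu₀0 : u₀ ≠ 0 := by rintro rfl; exact h.zero_notMem_right hu₀
  have hcard : Nat.card (MulAction.stabilizer (ZMod p)ˣ U) = U.card := by
    rw [← Nat.card_eq_finsetCard U]
    refine Nat.card_congr (Equiv.ofBijective
      (fun a => ⟨(a : (ZMod p)ˣ) • u₀, ?_⟩) ⟨fun a b hab => ?_, fun u => ?_⟩)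
    · have := Finset.smul_mem_smul_finset (a := (a : (ZMod p)ˣ)) hu₀
      rwa [MulAction.mem_stabilizer_iff.1 a.2] at this
    · exact Subtype.ext (Units.ext (by simpa [Units.smul_def, hu₀0] using hab))
    · obtain ⟨u, hu⟩ := u
      obtain ⟨a, hau, haU⟩ := h.exists_mul hu₀ hu
      have ha : a ≠ 0 := by
        rintro rfl
        rw [zero_mul] at hau
        exact h.zero_notMem_right (hau ▸ hu)
      refine ⟨⟨Units.mk0 a ha, ?_⟩, by simpa [Units.smul_def] using hau⟩
      rw [MulAction.mem_stabilizer_iff]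
      refine Finset.eq_of_subset_of_card_le (fun x hx => ?_)
        (Finset.card_smul_finset _ U).ge
      obtain ⟨y, hy, rfl⟩ := Finset.mem_smul_finset.1 hx
      exact haU y hy
  rw [← hcard, ← ZMod.card_units p, ← Nat.card_eq_fintype_card]
  exact Subgroup.card_subgroup_dvd_card _

lemma exists_card_le_two_mul [Fact p.Prime] (h : IsCoarcTransitivePartition S U)
    (hSU : S.card = U.card) : ∃ u ∈ U, U.card ≤ 2 * (S.filter (fun x => x - u ∈ S)).card := by
  obtain ⟨u₀, hu₀⟩ := h.right_nonempty
  obtain ⟨s₀, hs₀⟩ := h.left_nonempty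
  have hS0 : ∀ {x}, x ∈ S → x ≠ 0 := by rintro x hx rfl; exact h.zero_notMem_left hx
  have hU0 : ∀ {x}, x ∈ U → x ≠ 0 := by rintro x hx rfl; exact h.zero_notMem_right hx
  have hSnU : ∀ {x}, x ∈ S → x ∉ U := fun hx => (h.mem_left_iff _ (hS0 hx)).1 hx
  set t := s₀ / u₀
  have ht : t ≠ 0 := div_ne_zero (hS0 hs₀) (hU0 hu₀)
  have htU : ∀ u ∈ U, t * u ∈ S := by
    intro u hu
    rw [h.mem_left_iff _ (mul_ne_zero ht (hU0 hu))]
    intro hn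
    obtain ⟨a, hau, ha⟩ := h.exists_mul hu hu₀
    have h1 := ha _ hn
    rw [mul_left_comm, hau, div_mul_cancel₀ _ (hU0 hu₀)] at h1
    exact hSnU hs₀ h1
  have htS : ∀ s ∈ S, t * s ∈ U := by
    intro s hs
    by_contra hn
    rw [← h.mem_left_iff _ (mul_ne_zero ht (hS0 hs))] at hn
    obtain ⟨u, hu, hus⟩ := Finset.surjOn_of_injOn_of_card_le (fun x => t * x) (s := U) (t := S)
      htU (mul_right_injective₀ ht).injOn hSU.le hn
    exact hSnU hs (mul_left_cancel₀ ht hus ▸ hu)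
  have hcount : (U.sigma fun u => S.filter (fun x => x - u ∈ U)).card ≤
      (U.sigma fun u => S.filter (fun x => x - u ∈ S)).card := by
    refine Finset.card_le_card_of_injOn (fun q => ⟨t * q.2, t * q.1⟩) ?_ ?_
    · rintro ⟨u, x⟩ hq
      simp only [Finset.coe_sigma, Finset.mem_filter, Set.mem_sigma_iff,
        Finset.mem_coe] at hq ⊢
      refine ⟨htS _ hq.2.1, htU _ hq.1, ?_⟩
      rw [← mul_sub]
      exact htU _ (by simpa using h.neg_mem_right _ hq.2.2)
    · rintro ⟨u, x⟩ - ⟨u', x'⟩ - hq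
      simp only [Sigma.mk.injEq, heq_eq_eq, mul_eq_mul_left_iff, ht, or_false] at hq ⊢
      exact hq.symm
  rw [Finset.card_sigma, Finset.card_sigma] at hcount
  by_contra! hlt
  have hsum := Finset.sum_lt_sum_of_nonempty h.right_nonempty hlt
  rw [← Finset.mul_sum] at hsum
  have hsplit : ∀ u ∈ U, (S.filter (fun x => x - u ∈ U)).card +
      (S.filter (fun x => x - u ∈ S)).card = U.card := by
    intro u hu
    rw [← hSU, ← Finset.card_filter_add_card_filter_not (s := S) (fun x => x - u ∈ U)]
    congr 2
    refine Finset.filter_congr fun x hx => h.mem_left_iff _ (sub_ne_zero.2 ?_)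
    rintro rfl
    exact hSnU hx hu
  have := Finset.sum_congr rfl hsplit
  rw [Finset.sum_add_distrib] at this
  lia

end IsCoarcTransitivePartition

theorem SimpleGraph.exists_circulant_labelling {X : Type*} [Fintype X] {p : ℕ} [Fact p.Prime]
    (hX : Fintype.card X = p) (L : SimpleGraph X) (hL : ∀ x y, ∃ φ : L ≃g L, φ x = y) :
    ∃ (f : ZMod p ≃ X) (S : Finset (ZMod p)), ∀ i j, L.Adj (f i) (f j) ↔ j - i ∈ S := by
  classical
  have hp : p.Prime := Fact.out
  obtain ⟨x₀⟩ : Nonempty X := Fintype.card_pos_iff.1 (hX ▸ hp.pos)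
  let toPerm : (L ≃g L) →* Equiv.Perm X :=
    { toFun := fun φ => φ.toEquiv, map_one' := rfl, map_mul' := fun _ _ => rfl }
  have : MulAction.IsPretransitive toPerm.range X := ⟨fun x y => by
    obtain ⟨φ, hφ⟩ := hL x y
    exact ⟨⟨_, φ, rfl⟩, hφ⟩⟩
  have hdvd : p ∣ Nat.card toPerm.range := by
    have := MulAction.index_stabilizer_of_transitive toPerm.range x₀
    rw [← hX, ← Nat.card_eq_fintype_card, ← this]
    exact Subgroup.index_dvd_card _
  obtain ⟨g, hg⟩ := exists_prime_orderOf_dvd_card' p hdvd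
  obtain ⟨σ, φ, hφ⟩ := g
  have hσ : orderOf σ = p := by rw [← hg, ← Subgroup.orderOf_coe]
  have hφσ : ∀ x, σ x = φ x := fun x => by rw [← hφ]; rfl
  have hcyc : σ.IsCycle := Equiv.Perm.isCycle_of_prime_order'' (hX ▸ hp) (hσ.trans hX.symm)
  have hσadj : ∀ (n : ℕ) x y, L.Adj ((σ ^ n) x) ((σ ^ n) y) ↔ L.Adj x y := by
    intro n
    induction n with
    | zero => simp
    | succ n ih =>
      intro x y
      rw [pow_succ', Equiv.Perm.mul_apply, Equiv.Perm.mul_apply, ← ih x y, hφσ, hφσ]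
      exact φ.map_adj_iff
  have hpow : ∀ i j : ZMod p, σ ^ (i + j).val = σ ^ i.val * σ ^ j.val := by
    intro i j
    rw [← pow_add, pow_eq_pow_iff_modEq, hσ, ZMod.val_add]
    exact Nat.mod_modEq _ _
  have hsupp : ∀ x, σ x ≠ x := by
    intro x
    have h1 := hcyc.orderOf
    rw [hσ, ← hX, eq_comm, Finset.card_eq_iff_eq_univ] at h1
    exact Equiv.Perm.mem_support.1 (h1 ▸ Finset.mem_univ x)
  have hsurj : Function.Surjective fun i : ZMod p => (σ ^ i.val) x₀ := by
    intro y
    obtain ⟨n, hn⟩ := hcyc.exists_pow_eq (hsupp x₀) (hsupp y)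
    refine ⟨(n : ZMod p), ?_⟩
    dsimp only
    rw [← hn, ZMod.val_natCast, ← hσ, pow_mod_orderOf]
  have hbij := (Fintype.bijective_iff_surjective_and_card _).2
    ⟨hsurj, (ZMod.card p).trans hX.symm⟩
  refine ⟨Equiv.ofBijective _ hbij, Finset.univ.filter fun i => L.Adj x₀ ((σ ^ i.val) x₀), ?_⟩
  intro i j
  rw [Finset.mem_filter, ← hσadj i.val x₀, ← Equiv.Perm.mul_apply, ← hpow]
  simp

open Classical in
/-- The vertices at distance two from `v`. -/
noncomputable def SimpleGraph.secondNeighborFinset {V : Type*} [Fintype V] (Γ : SimpleGraph V)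
    (v : V) : Finset V :=
  Finset.univ.filter fun w => ∃ u, Is2Geodesic Γ v u w

lemma SimpleGraph.mem_secondNeighborFinset {V : Type*} [Fintype V] {Γ : SimpleGraph V} {v w : V} :
    w ∈ Γ.secondNeighborFinset v ↔ ∃ u, Is2Geodesic Γ v u w := by
  simp [secondNeighborFinset]

lemma Is2Geodesic.symm {V : Type*} {Γ : SimpleGraph V} {v u w : V} (h : Is2Geodesic Γ v u w) :
    Is2Geodesic Γ w u v :=
  ⟨h.2.1.symm, h.1.symm, h.2.2.1.symm, fun h' => h.2.2.2 h'.symm⟩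

section counting

variable {V : Type*} [Fintype V] [DecidableEq V] {Γ : SimpleGraph V} [DecidableRel Γ.Adj]

lemma card_neighborFinset_sdiff_erase {u v : V} (h : Γ.Adj u v) :
    ((Γ.neighborFinset u \ Γ.neighborFinset v).erase v).card +
      (Γ.neighborFinset u ∩ Γ.neighborFinset v).card + 1 = (Γ.neighborFinset u).card := by
  have hv : v ∈ Γ.neighborFinset u \ Γ.neighborFinset v := by simp [h]
  have h1 := Finset.card_erase_add_one hv
  have h2 := Finset.card_sdiff_add_card_inter (Γ.neighborFinset u) (Γ.neighborFinset v)
  lia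

lemma Is2Geodesic.card_le {v u w : V} (h : Is2Geodesic Γ v u w) :
    (Γ.neighborFinset u ∩ Γ.neighborFinset v).card + 2 ≤
      (Γ.neighborFinset v ∩ Γ.neighborFinset w).card +
        ((Γ.neighborFinset u \ Γ.neighborFinset w).erase w).card := by
  have hu : u ∈ Γ.neighborFinset v ∩ Γ.neighborFinset w := by simp [h.1, h.2.1.symm]
  have hv : v ∈ (Γ.neighborFinset u \ Γ.neighborFinset w).erase w := by
    have : ¬ Γ.Adj w v := h.symm.2.2.2
    simp [h.1.symm, h.2.2.1, this]
  have hsub : Γ.neighborFinset u ∩ Γ.neighborFinset v ⊆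
      ((Γ.neighborFinset v ∩ Γ.neighborFinset w).erase u) ∪
        (((Γ.neighborFinset u \ Γ.neighborFinset w).erase w).erase v) := by
    intro x hx
    simp only [Finset.mem_inter, mem_neighborFinset, Finset.mem_union, Finset.mem_erase,
      Finset.mem_sdiff] at hx ⊢
    by_cases hwx : Γ.Adj w x
    · exact .inl ⟨hx.1.ne', hx.2, hwx⟩
    · refine .inr ⟨hx.2.ne', ?_, hx.1, hwx⟩
      rintro rfl
      exact h.2.2.2 hx.2
  have h1 := (Finset.card_le_card hsub).trans (Finset.card_union_le _ _)
  have h2 := Finset.card_erase_add_one hu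
  have h3 := Finset.card_erase_add_one hv
  lia

lemma card_mul_eq_card_secondNeighborFinset_mul {d m c : ℕ} {v : V}
    (hd : (Γ.neighborFinset v).card = d)
    (hm : ∀ u, Γ.Adj u v → ((Γ.neighborFinset u \ Γ.neighborFinset v).erase v).card = m)
    (hc : ∀ u w, Is2Geodesic Γ v u w → (Γ.neighborFinset v ∩ Γ.neighborFinset w).card = c) :
    d * m = (Γ.secondNeighborFinset v).card * c := by
  rw [← hd]
  refine Finset.card_mul_eq_card_mul Γ.Adj (fun u hu => ?_) (fun w hw => ?_)
  · rw [mem_neighborFinset] at hu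
    rw [← hm u hu.symm]
    congr 1
    ext w
    simp only [Finset.mem_bipartiteAbove, mem_secondNeighborFinset, Finset.mem_erase,
      Finset.mem_sdiff, mem_neighborFinset]
    exact ⟨fun ⟨⟨_, h⟩, huw⟩ => ⟨h.2.2.1.symm, huw, h.2.2.2⟩,
      fun ⟨h, huw, h'⟩ => ⟨⟨u, hu, huw, h.symm, h'⟩, huw⟩⟩
  · obtain ⟨u, hu⟩ := mem_secondNeighborFinset.1 hw
    rw [← hc u w hu]
    congr 1
    ext x
    simp [Finset.mem_bipartiteBelow, Γ.adj_comm w x]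

end counting

/-- Local conditions characterising the nonbipartite antipodal double covers of complete graphs
considered here. -/
structure HasTaylorParameters {V : Type*} [Fintype V] [DecidableEq V] (Γ : SimpleGraph V)
    [DecidableRel Γ.Adj] (m : ℕ) : Prop where
  pos : 0 < m
  card_neighborFinset : ∀ v, (Γ.neighborFinset v).card = 2 * m + 1
  card_inter_of_adj : ∀ u v, Γ.Adj u v → (Γ.neighborFinset u ∩ Γ.neighborFinset v).card = m
  card_inter_of_geodesic : ∀ v u w, Is2Geodesic Γ v u w →
    (Γ.neighborFinset v ∩ Γ.neighborFinset w).card = m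
  exists_not_adj : ∀ u v x, Γ.Adj u v → Γ.Adj u x → Γ.Adj v x →
    ∃ y, Γ.Adj u y ∧ Γ.Adj x y ∧ v ≠ y ∧ ¬ Γ.Adj v y
  mem_of_adj_closed : ∀ (u : V) (T : Set V), (∃ x ∈ T, Γ.Adj u x) →
    (∀ x ∈ T, Γ.Adj u x → ∀ y, Γ.Adj u y → Γ.Adj x y → y ∈ T) → ∀ y, Γ.Adj u y → y ∈ T

namespace HasTaylorParameters

variable {V : Type*} [Fintype V] [DecidableEq V] {Γ : SimpleGraph V} [DecidableRel Γ.Adj] {m : ℕ}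

lemma card_sdiff_erase (h : HasTaylorParameters Γ m) {u v : V} (huv : Γ.Adj u v) :
    ((Γ.neighborFinset u \ Γ.neighborFinset v).erase v).card = m := by
  have := card_neighborFinset_sdiff_erase huv
  rw [h.card_inter_of_adj u v huv, h.card_neighborFinset] at this
  lia

lemma card_secondNeighborFinset (h : HasTaylorParameters Γ m) (v : V) :
    (Γ.secondNeighborFinset v).card = 2 * m + 1 := by
  have := card_mul_eq_card_secondNeighborFinset_mul (h.card_neighborFinset v)
    (fun u hu => h.card_sdiff_erase hu) (fun u w => h.card_inter_of_geodesic v u w)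
  exact (Nat.eq_of_mul_eq_mul_right h.pos this).symm

lemma even_card (h : HasTaylorParameters Γ m) : Even (Fintype.card V) := by
  have h1 := Γ.sum_degrees_eq_twice_card_edges
  simp only [← card_neighborFinset_eq_degree, h.card_neighborFinset, Finset.sum_const,
    Finset.card_univ, smul_eq_mul] at h1
  have h2 : Even (Fintype.card V * (2 * m + 1)) := h1 ▸ even_two_mul _
  rw [Nat.even_mul] at h2
  refine h2.resolve_right ?_
  rw [Nat.not_even_iff_odd]
  exact odd_two_mul_add_one m

lemma exists_far (h : HasTaylorParameters Γ m) (hconn : Γ.Connected) (v : V) :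
    ∃ w z, w ∈ Γ.secondNeighborFinset v ∧ Γ.Adj w z ∧ v ≠ z ∧ ¬ Γ.Adj v z ∧
      z ∉ Γ.secondNeighborFinset v := by
  set K : Finset V := insert v (Γ.neighborFinset v ∪ Γ.secondNeighborFinset v) with hK
  obtain ⟨y, hy⟩ : ∃ y, y ∉ K := by
    by_contra! hall
    have hdisj : Disjoint (Γ.neighborFinset v) (Γ.secondNeighborFinset v) :=
      Finset.disjoint_left.2 fun x hx hx' => by
        obtain ⟨u, hu⟩ := mem_secondNeighborFinset.1 hx'
        exact hu.2.2.2 (by simpa using hx)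
    have hv : v ∉ Γ.neighborFinset v ∪ Γ.secondNeighborFinset v := by
      simp [mem_secondNeighborFinset, Is2Geodesic]
    have hcard : K.card = Fintype.card V := by
      rw [Finset.card_eq_iff_eq_univ]
      exact Finset.eq_univ_iff_forall.2 hall
    rw [hK, Finset.card_insert_of_notMem hv, Finset.card_union_of_disjoint hdisj,
      h.card_neighborFinset, h.card_secondNeighborFinset] at hcard
    obtain ⟨r, hr⟩ := h.even_card
    lia
  obtain ⟨q⟩ := hconn.preconnected v y
  obtain ⟨d, -, hw, hz⟩ := q.exists_boundary_dart (K : Set V) (by simp [hK]) hy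
  have hadj := d.adj
  generalize d.fst = w at *
  generalize d.snd = z at *
  simp only [hK, Finset.coe_insert, Finset.coe_union, Set.mem_insert_iff, Set.mem_union,
    Finset.mem_coe, mem_neighborFinset, not_or] at hw hz
  refine ⟨w, z, ?_, hadj, Ne.symm hz.1, hz.2.1, hz.2.2⟩
  rcases hw with rfl | hw | hw
  · exact absurd hadj hz.2.1
  · exact absurd (mem_secondNeighborFinset.2 ⟨w, hw, hadj, Ne.symm hz.1, hz.2.1⟩) hz.2.2
  · exact hw

lemma secondNeighborFinset_eq (h : HasTaylorParameters Γ m) {v w z : V}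
    (hw : w ∈ Γ.secondNeighborFinset v) (hwz : Γ.Adj w z) (hvz : v ≠ z) (hnadj : ¬ Γ.Adj v z)
    (hz : z ∉ Γ.secondNeighborFinset v) : Γ.secondNeighborFinset v = Γ.neighborFinset z := by
  have hno : ∀ x, Γ.Adj v x → ¬ Γ.Adj x z := fun x hvx hxz =>
    hz (mem_secondNeighborFinset.2 ⟨x, hvx, hxz, hvz, hnadj⟩)
  have hstep : ∀ u w, Γ.Adj v u → Γ.Adj u w → Γ.Adj w z →
      ∀ x, Γ.Adj u x → v ≠ x → ¬ Γ.Adj v x → Γ.Adj x z := by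
    intro u w hvu huw hwz x hux hvx hnvx
    have hgeo : Is2Geodesic Γ u w z :=
      ⟨huw, hwz, fun e => hnadj (e ▸ hvu), hno u hvu⟩
    have hsub : Γ.neighborFinset u ∩ Γ.neighborFinset z ⊆
        (Γ.neighborFinset u \ Γ.neighborFinset v).erase v := by
      intro y hy
      simp only [Finset.mem_inter, mem_neighborFinset, Finset.mem_erase, Finset.mem_sdiff] at hy ⊢
      refine ⟨?_, hy.1, fun hvy => hno y hvy hy.2.symm⟩
      rintro rfl
      exact hnadj hy.2.symm
    have heq := Finset.eq_of_subset_of_card_le hsub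
      ((h.card_sdiff_erase hvu.symm).trans (h.card_inter_of_geodesic _ _ _ hgeo).symm).le
    have hx : x ∈ (Γ.neighborFinset u \ Γ.neighborFinset v).erase v := by
      simp [hvx.symm, hux, hnvx]
    rw [← heq, Finset.mem_inter, mem_neighborFinset, mem_neighborFinset] at hx
    exact hx.2.symm
  obtain ⟨u₀, hu₀⟩ := mem_secondNeighborFinset.1 hw
  have hall := h.mem_of_adj_closed v {u | ∃ w, Γ.Adj u w ∧ Γ.Adj w z}
    ⟨u₀, ⟨w, hu₀.2.1, hwz⟩, hu₀.1⟩ (by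
      rintro u ⟨w, huw, hwz⟩ hvu u' hvu' huu'
      obtain ⟨y, huy, huy', hvy, hnvy⟩ := h.exists_not_adj u v u' hvu.symm huu' hvu'
      exact ⟨y, huy', hstep u w hvu huw hwz y huy hvy hnvy⟩)
  refine Finset.eq_of_subset_of_card_le (fun x hx => ?_)
    ((h.card_neighborFinset z).trans (h.card_secondNeighborFinset v).symm).le
  obtain ⟨u, hu⟩ := mem_secondNeighborFinset.1 hx
  obtain ⟨w, huw, hwz⟩ := hall u hu.1
  rw [mem_neighborFinset]
  exact (hstep u w hu.1 huw hwz x hu.2.1 hu.2.2.1 hu.2.2.2).symm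

/-- Every vertex `v` has an antipode `z`: the neighbourhoods of `v` and `z` partition the other
vertices. -/
theorem exists_antipode (h : HasTaylorParameters Γ m) (hconn : Γ.Connected) (v : V) :
    ∃ z, v ≠ z ∧ (∀ x, Γ.dist v x = 3 ↔ x = z) ∧
      ∀ x, Γ.Adj z x ↔ x ≠ v ∧ x ≠ z ∧ ¬ Γ.Adj v x := by
  obtain ⟨w, z, hw, hwz, hvz, hnadj, hz⟩ := h.exists_far hconn v
  have heq := h.secondNeighborFinset_eq hw hwz hvz hnadj hz
  have hno : ∀ x, Γ.Adj v x → ¬ Γ.Adj x z := fun x hvx hxz =>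
    hz (mem_secondNeighborFinset.2 ⟨x, hvx, hxz, hvz, hnadj⟩)
  obtain ⟨u, hu⟩ := mem_secondNeighborFinset.1 hw
  have heq' := h.secondNeighborFinset_eq (v := z) (z := v)
    (mem_secondNeighborFinset.2 ⟨w, hwz.symm, hu.2.1.symm, fun e => hnadj (e ▸ hu.1),
      fun h' => hno u hu.1 h'.symm⟩) hu.1.symm hvz.symm (fun h' => hnadj h'.symm) (fun hv => by
        obtain ⟨x, hx⟩ := mem_secondNeighborFinset.1 hv
        exact hno x hx.2.1.symm hx.1.symm)
  have hmem : ∀ x, Γ.Adj z x ↔ ∃ u, Is2Geodesic Γ v u x := fun x => by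
    rw [← mem_neighborFinset, ← heq, mem_secondNeighborFinset]
  have hmem' : ∀ x, Γ.Adj v x ↔ ∃ u, Is2Geodesic Γ z u x := fun x => by
    rw [← mem_neighborFinset, ← heq', mem_secondNeighborFinset]
  have hcover : ∀ x, x = v ∨ x = z ∨ Γ.Adj v x ∨ Γ.Adj z x := by
    by_contra! hcon
    obtain ⟨y, hy⟩ := hcon
    obtain ⟨q⟩ := hconn.preconnected v y
    obtain ⟨d, -, hx, hx'⟩ := q.exists_boundary_dart
      {x | x = v ∨ x = z ∨ Γ.Adj v x ∨ Γ.Adj z x} (.inl rfl) (by simpa using hy)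
    have hadj := d.adj
    generalize d.fst = x at *
    generalize d.snd = x' at *
    simp only [Set.mem_ofPred_eq, not_or] at hx hx'
    obtain ⟨hx'v, hx'z, hvx', hzx'⟩ := hx'
    rcases hx with rfl | rfl | hx | hx
    · exact hvx' hadj
    · exact hzx' hadj
    · exact hzx' ((hmem x').2 ⟨x, hx, hadj, Ne.symm hx'v, hvx'⟩)
    · exact hvx' ((hmem' x').2 ⟨x, hx, hadj, Ne.symm hx'z, hzx'⟩)
  have hdist2 : ∀ x, Γ.Adj z x → Γ.dist v x ≤ 2 := fun x hx => by
    obtain ⟨u, hu⟩ := (hmem x).1 hx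
    exact dist_le (.cons hu.1 (.cons hu.2.1 .nil))
  have hdist3 : Γ.dist v z = 3 := by
    refine le_antisymm (dist_le (.cons hu.1 (.cons hu.2.1 (.cons hwz .nil)))) ?_
    by_contra! hlt
    obtain ⟨q, hq⟩ := hconn.exists_walk_length_eq_dist v z
    rw [← hq] at hlt
    match q with
    | .nil => exact hvz rfl
    | .cons h1 .nil => exact hnadj h1
    | .cons h1 (.cons h2 .nil) => exact hno _ h1 h2
    | .cons h1 (.cons h2 (.cons h3 q)) =>
      simp only [Walk.length_cons] at hlt
      lia
  refine ⟨z, hvz, fun x => ⟨fun hx => ?_, fun hx => hx ▸ hdist3⟩, fun x => ⟨fun hx => ?_, ?_⟩⟩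
  · rcases hcover x with rfl | rfl | h' | h'
    · simp at hx
    · rfl
    · rw [dist_eq_one_iff_adj.2 h'] at hx
      lia
    · have := hdist2 x h'
      lia
  · refine ⟨?_, hx.ne', fun h' => hno x h' hx.symm⟩
    rintro rfl
    exact hnadj hx.symm
  · rintro ⟨h1, h2, h3⟩
    rcases hcover x with h' | h' | h' | h'
    exacts [absurd h' h1, absurd h' h2, absurd h' h3, h']

end HasTaylorParameters

/-- The automorphism of the graph induced on the neighbourhood of `u` by an automorphism fixing
`u`. -/
def SimpleGraph.Iso.onNeighborSet {V : Type*} {Γ : SimpleGraph V} {u : V} (φ : Γ ≃g Γ)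
    (hφ : φ u = u) : Γ.induce (Γ.neighborSet u) ≃g Γ.induce (Γ.neighborSet u) where
  toEquiv := φ.toEquiv.subtypeEquiv fun x => by
    rw [mem_neighborSet, mem_neighborSet]
    conv_rhs => rw [← hφ]
    exact φ.map_adj_iff.symm
  map_rel_iff' := φ.map_adj_iff

/-- The neighbourhood of each vertex induces a circulant graph whose non-adjacent pairs form one
orbit. -/
theorem TwoGeodesicTransitive.exists_circulant {V : Type*} [Fintype V] {Γ : SimpleGraph V} {p : ℕ}
    [Fact p.Prime] (h : TwoGeodesicTransitive Γ) {u : V}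
    (hu : Nat.card (Γ.neighborSet u) = p)
    (htri : ∃ x y, Γ.Adj u x ∧ Γ.Adj u y ∧ Γ.Adj x y) (hgeo : ∃ x y, Is2Geodesic Γ x u y) :
    ∃ (f : ZMod p ≃ Γ.neighborSet u) (S U : Finset (ZMod p)),
      IsCoarcTransitivePartition S U ∧ ∀ i j, Γ.Adj (f i) (f j) ↔ j - i ∈ S := by
  classical
  obtain ⟨f, S, hf⟩ := SimpleGraph.exists_circulant_labelling (p := p)
    (by rw [← hu, Nat.card_eq_fintype_card]) (Γ.induce (Γ.neighborSet u)) fun x y => by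
      obtain ⟨φ, hφu, hφ⟩ := h.1 x.2 y.2
      exact ⟨φ.onNeighborSet hφu, Subtype.ext hφ⟩
  simp only [comap_adj, Function.Embedding.subtype_apply] at hf
  have hf' : ∀ x y : Γ.neighborSet u, Γ.Adj x y ↔ f.symm y - f.symm x ∈ S := fun x y => by
    rw [← hf, f.apply_symm_apply, f.apply_symm_apply]
  have h0 : (0 : ZMod p) ∉ S := by
    rw [← sub_self 0, ← hf]
    exact Γ.irrefl
  have hneg : ∀ x, -x ∈ S → x ∈ S := by
    intro x hx
    rw [← zero_sub, ← hf] at hx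
    rw [← sub_zero x, ← hf]
    exact hx.symm
  have hgeodesic : ∀ i : ZMod p, i ≠ 0 → i ∉ S → Is2Geodesic Γ (f 0) u (f i) := by
    intro i hi0 hi
    refine ⟨(f 0).2.symm, (f i).2, ?_, ?_⟩
    · rw [Ne, Subtype.coe_inj, f.injective.eq_iff]
      exact hi0.symm
    · rwa [hf, sub_zero]
  refine ⟨f, S, Finset.univ.filter fun i => i ≠ 0 ∧ i ∉ S, ⟨h0, by simp, ?_, ?_, ?_, ?_, ?_⟩, hf⟩
  · intro x hx
    simp [hx]
  · intro x hx
    simp only [Finset.mem_filter, Finset.mem_univ, true_and] at hx ⊢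
    exact ⟨neg_ne_zero.2 hx.1, fun h' => hx.2 (hneg x h')⟩
  · obtain ⟨x, y, hx, hy, hxy⟩ := htri
    exact ⟨_, (hf' ⟨x, hx⟩ ⟨y, hy⟩).1 hxy⟩
  · obtain ⟨x, y, hx, hy, hne, hxy⟩ := hgeo
    refine ⟨f.symm ⟨y, hy⟩ - f.symm ⟨x, hx.symm⟩, ?_⟩
    simp only [Finset.mem_filter, Finset.mem_univ, true_and, ← hf']
    refine ⟨?_, hxy⟩
    rw [sub_ne_zero, f.symm.injective.ne_iff]
    exact fun h' => hne (congrArg Subtype.val h').symm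
  · intro i hi j hj
    simp only [Finset.mem_filter, Finset.mem_univ, true_and] at hi hj
    obtain ⟨φ, hφ0, hφu, hφi⟩ := h.2 (hgeodesic i hi.1 hi.2) (hgeodesic j hj.1 hj.2)
    refine ⟨(f.trans (φ.onNeighborSet hφu).toEquiv).trans f.symm, fun x y => ?_, ?_, ?_⟩
    · rw [← hf, ← hf]
      simpa using (φ.onNeighborSet hφu).map_adj_iff (v := f x) (w := f y)
    · simp only [Equiv.trans_apply, Equiv.symm_apply_eq]
      exact Subtype.ext hφ0
    · simp only [Equiv.trans_apply, Equiv.symm_apply_eq]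
      exact Subtype.ext hφi

section circulantNeighborhood

variable {V : Type*} {Γ : SimpleGraph V} {p : ℕ} {u : V} {S U : Finset (ZMod p)}

lemma card_neighborFinset_inter_of_circulant [Fintype V] [DecidableEq V] [DecidableRel Γ.Adj]
    [Fact p.Prime] (f : ZMod p ≃ Γ.neighborSet u)
    (hf : ∀ i j, Γ.Adj (f i) (f j) ↔ j - i ∈ S) {v : V} (huv : Γ.Adj u v) :
    (Γ.neighborFinset u ∩ Γ.neighborFinset v).card = S.card := by
  obtain ⟨i, hi⟩ := f.surjective ⟨v, huv⟩
  symm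
  refine Finset.card_bij (fun s _ => (f (i + s) : V)) (fun s hs => ?_) (fun s _ t _ hst => ?_)
    fun x hx => ?_
  · rw [Finset.mem_inter, mem_neighborFinset, mem_neighborFinset]
    refine ⟨(f (i + s)).2, ?_⟩
    have := (hf i (i + s)).2 (by simpa using hs)
    rwa [hi] at this
  · simpa using f.injective (Subtype.ext hst)
  · rw [Finset.mem_inter, mem_neighborFinset, mem_neighborFinset] at hx
    obtain ⟨j, hj⟩ := f.surjective ⟨x, hx.1⟩
    refine ⟨j - i, ?_, by simp [hj]⟩
    rw [← hf, hi, hj]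
    exact hx.2

lemma exists_two_geodesic_card_le [Fintype V] [DecidableEq V] [DecidableRel Γ.Adj]
    [Fact p.Prime] (h : IsCoarcTransitivePartition S U)
    (f : ZMod p ≃ Γ.neighborSet u) (hf : ∀ i j, Γ.Adj (f i) (f j) ↔ j - i ∈ S)
    (hSU : S.card = U.card) : ∃ v w, Is2Geodesic Γ v u w ∧
      U.card + 2 ≤ 2 * (Γ.neighborFinset v ∩ Γ.neighborFinset w).card := by
  obtain ⟨i, hi, hcard⟩ := h.exists_card_le_two_mul hSU
  have hi0 : i ≠ 0 := by rintro rfl; exact h.zero_notMem_right hi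
  refine ⟨f 0, f i, ⟨(f 0).2.symm, (f i).2, ?_, ?_⟩, ?_⟩
  · rw [Ne, Subtype.coe_inj, f.injective.eq_iff]
    exact hi0.symm
  · rw [hf, sub_zero, h.mem_left_iff _ hi0, not_not]
    exact hi
  · have hsub : insert u ((S.filter fun x => x - i ∈ S).image fun x => (f x : V)) ⊆
        Γ.neighborFinset (f 0) ∩ Γ.neighborFinset (f i) := by
      intro x hx
      rw [Finset.mem_inter, mem_neighborFinset, mem_neighborFinset]
      rw [Finset.mem_insert, Finset.mem_image] at hx
      rcases hx with rfl | ⟨j, hj, rfl⟩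
      · exact ⟨(f 0).2.symm, (f i).2.symm⟩
      · rw [Finset.mem_filter] at hj
        rw [hf, hf, sub_zero]
        exact hj
    have hle := Finset.card_le_card hsub
    rw [Finset.card_insert_of_notMem, Finset.card_image_of_injective (f := fun x => (f x : V)) _
      (Subtype.val_injective.comp f.injective)] at hle
    · lia
    · rw [Finset.mem_image]
      rintro ⟨j, -, hj⟩
      exact (f j).2.ne hj.symm

lemma exists_adj_of_circulant [Fact p.Prime] (h : IsCoarcTransitivePartition S U)
    (f : ZMod p ≃ Γ.neighborSet u) (hf : ∀ i j, Γ.Adj (f i) (f j) ↔ j - i ∈ S) {v w : V}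
    (hvw : Is2Geodesic Γ v u w) : ∃ x, Γ.Adj u x ∧ Γ.Adj v x ∧ ¬ Γ.Adj w x := by
  obtain ⟨i, hi⟩ := f.surjective ⟨v, hvw.1.symm⟩
  obtain ⟨j, hj⟩ := f.surjective ⟨w, hvw.2.1⟩
  by_contra! hcon
  have hij : i - j ≠ 0 := by
    rw [sub_ne_zero]
    rintro rfl
    exact hvw.2.2.1 (congrArg Subtype.val (hi.symm.trans hj))
  refine h.zero_notMem_left (ZMod.mem_of_add_mem (T := (S : Set (ZMod p))) h.left_nonempty hij
    (fun x hx => ?_) 0)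
  have h1 := hcon (f (x + i)) (f (x + i)).2
  rw [show v = f i by rw [hi], show w = f j by rw [hj], hf, hf] at h1
  simpa [add_sub_assoc] using h1 (by simpa using hx)

lemma exists_adj_not_adj_of_circulant [Fact p.Prime] (h : IsCoarcTransitivePartition S U)
    (f : ZMod p ≃ Γ.neighborSet u) (hf : ∀ i j, Γ.Adj (f i) (f j) ↔ j - i ∈ S) {v x : V}
    (huv : Γ.Adj u v) (hux : Γ.Adj u x) (hvx : Γ.Adj v x) :
    ∃ y, Γ.Adj u y ∧ Γ.Adj x y ∧ v ≠ y ∧ ¬ Γ.Adj v y := by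
  obtain ⟨i, hi⟩ := f.surjective ⟨v, huv⟩
  obtain ⟨j, hj⟩ := f.surjective ⟨x, hux⟩
  have hxj : x = f j := by rw [hj]
  have hvi : v = f i := by rw [hi]
  rw [hxj, hvi] at hvx
  by_contra! hcon
  have hij : i - j ≠ 0 := by
    rw [sub_ne_zero]
    rintro rfl
    exact hvx.ne rfl
  refine h.zero_notMem_right (ZMod.mem_of_add_mem (T := (U : Set (ZMod p))) h.right_nonempty hij
    (fun a ha => ?_) 0)
  have ha0 : a ≠ 0 := by rintro rfl; exact h.zero_notMem_right ha
  have h1 := hcon (f (a + i)) (f (a + i)).2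
  rw [hxj, hvi, hf, hf, Ne, Subtype.coe_inj, f.injective.eq_iff, add_sub_cancel_right] at h1
  by_contra hn
  rw [Finset.mem_coe, ← h.mem_left_iff, ← add_sub_assoc] at hn
  · exact (h.mem_left_iff a ha0).1 (h1 hn (by simpa using ha0)) ha
  · rw [← add_sub_assoc]
    intro h0
    have haj : a = j - i := by linear_combination h0
    rw [hf, ← haj, h.mem_left_iff a ha0] at hvx
    exact hvx ha

lemma mem_of_circulant [Fact p.Prime] (h : IsCoarcTransitivePartition S U)
    (f : ZMod p ≃ Γ.neighborSet u) (hf : ∀ i j, Γ.Adj (f i) (f j) ↔ j - i ∈ S) {T : Set V}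
    (hT : ∃ x ∈ T, Γ.Adj u x)
    (hadj : ∀ x ∈ T, Γ.Adj u x → ∀ y, Γ.Adj u y → Γ.Adj x y → y ∈ T) {y : V} (hy : Γ.Adj u y) :
    y ∈ T := by
  obtain ⟨x, hxT, hx⟩ := hT
  obtain ⟨s, hs⟩ := h.left_nonempty
  have hs0 : s ≠ 0 := by rintro rfl; exact h.zero_notMem_left hs
  have := ZMod.mem_of_add_mem (T := {i | (f i : V) ∈ T}) (s := s)
    ⟨f.symm ⟨x, hx⟩, by simpa using hxT⟩ hs0
    (fun i hi => hadj _ hi (f i).2 _ (f (i + s)).2 (by rw [hf]; simpa using hs)) (f.symm ⟨y, hy⟩)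
  simpa using this

end circulantNeighborhood

lemma SimpleGraph.exists_is2Geodesic {V : Type*} {Γ : SimpleGraph V} (hconn : Γ.Connected)
    (hnc : Γ ≠ ⊤) : ∃ v u w, Is2Geodesic Γ v u w := by
  by_contra! hno
  refine hnc (eq_top_iff.2 fun v w hvw => ?_)
  obtain ⟨q⟩ := hconn.preconnected v w
  have hne : v ≠ w := hvw
  induction q with
  | nil => exact absurd rfl hne
  | @cons a b c hab q ih =>
    by_cases hbc : b = c
    · exact hbc ▸ hab
    · by_contra hac
      exact hno a b c ⟨hab, ih hbc hbc, hne, hac⟩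

lemma TwoGeodesicTransitive.exists_triangle {V : Type*} {Γ : SimpleGraph V}
    (h : TwoGeodesicTransitive Γ) (h2at : ¬ TwoArcTransitive Γ) :
    ∃ u x y, Γ.Adj u x ∧ Γ.Adj u y ∧ Γ.Adj x y := by
  by_contra! hno
  have hgeo : ∀ v u w, Is2Arc Γ v u w → Is2Geodesic Γ v u w := fun v u w ha =>
    ⟨ha.1, ha.2.1, ha.2.2, hno u v w ha.1.symm ha.2.1⟩
  exact h2at ⟨h.1, fun v u w v' u' w' ha ha' => h.2 (hgeo _ _ _ ha) (hgeo _ _ _ ha')⟩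

lemma SimpleGraph.Iso.card_neighborFinset_inter {V : Type*} [Fintype V] [DecidableEq V]
    {Γ : SimpleGraph V} [DecidableRel Γ.Adj] (φ : Γ ≃g Γ) (v w : V) :
    (Γ.neighborFinset (φ v) ∩ Γ.neighborFinset (φ w)).card =
      (Γ.neighborFinset v ∩ Γ.neighborFinset w).card := by
  symm
  refine Finset.card_equiv φ.toEquiv fun x => ?_
  simp only [Finset.mem_inter, mem_neighborFinset]
  exact and_congr φ.map_adj_iff.symm φ.map_adj_iff.symm

/-- Two-geodesic transitivity with prime valency determines the local parameters. -/
theorem TwoGeodesicTransitive.exists_hasTaylorParameters {V : Type*} [Fintype V] [DecidableEq V]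
    {Γ : SimpleGraph V} [DecidableRel Γ.Adj] {p : ℕ} (hp : p.Prime)
    (hreg : ∀ v : V, Nat.card (Γ.neighborSet v) = p) (hconn : Γ.Connected) (hnc : Γ ≠ ⊤)
    (h : TwoGeodesicTransitive Γ) (h2at : ¬ TwoArcTransitive Γ) :
    ∃ m, p = 2 * m + 1 ∧ HasTaylorParameters Γ m := by
  have : Fact p.Prime := ⟨hp⟩
  have hdeg : ∀ v, (Γ.neighborFinset v).card = p := fun v => by
    rw [← hreg v, Nat.card_eq_fintype_card, card_neighborSet_eq_degree, card_neighborFinset_eq_degree]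
  have hnbr : ∀ v, ∃ u, Γ.Adj v u := fun v => by
    obtain ⟨u, hu⟩ := Finset.card_pos.1 ((hdeg v).symm ▸ hp.pos)
    exact ⟨u, by simpa using hu⟩
  have hvt : ∀ v w, ∃ φ : Γ ≃g Γ, φ v = w := fun v w => by
    obtain ⟨v', hv'⟩ := hnbr v
    obtain ⟨w', hw'⟩ := hnbr w
    obtain ⟨φ, hφ, -⟩ := h.1 hv' hw'
    exact ⟨φ, hφ⟩
  obtain ⟨v₁, u₁, w₁, hgeo₁⟩ := exists_is2Geodesic hconn hnc
  obtain ⟨u₂, x₂, y₂, hux₂, huy₂, hxy₂⟩ := h.exists_triangle h2at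
  have hcirc : ∀ u, ∃ (f : ZMod p ≃ Γ.neighborSet u) (S U : Finset (ZMod p)),
      IsCoarcTransitivePartition S U ∧ ∀ i j, Γ.Adj (f i) (f j) ↔ j - i ∈ S := by
    intro u
    obtain ⟨φ, hφ⟩ := hvt u₁ u
    obtain ⟨ψ, hψ⟩ := hvt u₂ u
    refine h.exists_circulant (hreg u) ⟨ψ x₂, ψ y₂, ?_⟩ ⟨φ v₁, φ w₁, ?_⟩
    · rw [← hψ, ψ.map_adj_iff, ψ.map_adj_iff, ψ.map_adj_iff]
      exact ⟨hux₂, huy₂, hxy₂⟩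
    · rw [Is2Geodesic, ← hφ, φ.map_adj_iff, φ.map_adj_iff, φ.map_adj_iff, φ.injective.ne_iff]
      exact hgeo₁
  obtain ⟨f, S, U, hSU, hf⟩ := hcirc u₁
  set m := U.card with hm
  have hkmp := hSU.card_add_card
  have hm0 : 0 < m := hSU.right_nonempty.card_pos
  have hk0 : 0 < S.card := hSU.left_nonempty.card_pos
  have hadj : ∀ u v, Γ.Adj u v → (Γ.neighborFinset u ∩ Γ.neighborFinset v).card = S.card := by
    intro u v huv
    obtain ⟨φ, rfl, rfl⟩ := h.1 hgeo₁.1.symm huv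
    rw [φ.card_neighborFinset_inter]
    exact card_neighborFinset_inter_of_circulant f hf hgeo₁.1.symm
  have hsdiff : ∀ u v, Γ.Adj u v →
      ((Γ.neighborFinset u \ Γ.neighborFinset v).erase v).card = m := by
    intro u v huv
    have := card_neighborFinset_sdiff_erase huv
    rw [hadj u v huv, hdeg] at this
    lia
  set c := (Γ.neighborFinset v₁ ∩ Γ.neighborFinset w₁).card with hc
  have hgeo : ∀ v u w, Is2Geodesic Γ v u w →
      (Γ.neighborFinset v ∩ Γ.neighborFinset w).card = c := by
    intro v u w hvuw
    obtain ⟨φ, rfl, rfl, rfl⟩ := h.2 hgeo₁ hvuw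
    exact φ.card_neighborFinset_inter _ _
  have hcpos : 0 < c := Finset.card_pos.2 ⟨u₁, by simp [hgeo₁.1, hgeo₁.2.1.symm]⟩
  have hcp : c < p := by
    rw [← hdeg v₁]
    refine Finset.card_lt_card
      ((Finset.ssubset_iff_of_subset Finset.inter_subset_left).2 ?_)
    obtain ⟨x, -, hvx, hwx⟩ := exists_adj_of_circulant hSU f hf hgeo₁
    exact ⟨x, by simpa using hvx, by simp [hwx]⟩
  have hcm : c ∣ m := by
    have hmul := card_mul_eq_card_secondNeighborFinset_mul (hdeg v₁)
      (fun u hu => hsdiff u v₁ hu) (hgeo v₁)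
    exact (Nat.coprime_of_lt_prime hcpos.ne' hcp hp).symm.dvd_of_dvd_mul_left
      (Dvd.intro_left _ hmul.symm)
  have hle := hgeo₁.card_le
  rw [hadj _ _ hgeo₁.1.symm, hsdiff _ _ hgeo₁.2.1, ← hc] at hle
  have hcm' := Nat.le_of_dvd hm0 hcm
  have hkm : S.card = m := by
    have hdvd : m ∣ S.card := by
      have := hSU.card_right_dvd
      rw [show p - 1 = S.card + m by lia] at this
      exact (Nat.dvd_add_left dvd_rfl).1 this
    obtain ⟨r, hr⟩ := hdvd
    have hr2 : r < 2 := by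
      by_contra! hr2
      have := Nat.mul_le_mul_left m hr2
      lia
    interval_cases r <;> lia
  have hcm2 : c = m := by
    obtain ⟨v, w, hvw, hcard⟩ := exists_two_geodesic_card_le hSU f hf hkm
    rw [hgeo v u₁ w hvw, ← hm] at hcard
    obtain ⟨r, hr⟩ := hcm
    have hr2 : r < 2 := by
      by_contra! hr2
      have := Nat.mul_le_mul_left c hr2
      lia
    interval_cases r <;> lia
  refine ⟨m, by lia, hm0, fun v => by rw [hdeg]; lia, fun u v huv => (hadj u v huv).trans hkm,
    fun v u w hvw => (hgeo v u w hvw).trans hcm2, fun u v x huv hux hvx => ?_,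
    fun u T hT hclosed y hy => ?_⟩
  · obtain ⟨f, S, U, hSU, hf⟩ := hcirc u
    exact exists_adj_not_adj_of_circulant hSU f hf huv hux hvx
  · obtain ⟨f, S, U, hSU, hf⟩ := hcirc u
    exact mem_of_circulant hSU f hf hT hclosed hy

theorem stmt16 {V : Type*} [Fintype V] (Γ : SimpleGraph V) (p : ℕ)
    (hp : p.Prime)
    (hreg : ∀ v : V, Nat.card (Γ.neighborSet v) = p)
    (hconn : Γ.Connected)
    (hnc : Γ ≠ ⊤)
    (h2gt : TwoGeodesicTransitive Γ)
    (h2at : ¬ TwoArcTransitive Γ) :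
    ¬ Γ.Colorable 2 ∧
    Nat.card V = 2 * p + 2 ∧
    (∀ v : V, ∃! v' : V, Γ.dist v v' = 3) ∧
    (∀ v x x' : V, Γ.dist x x' = 3 → v ≠ x → v ≠ x' → (Γ.Adj v x ↔ ¬ Γ.Adj v x')) ∧
    (∀ v x : V, v ≠ x → Γ.dist v x ≠ 3 →
      Γ.Adj v x ∨ ∃ x' : V, Γ.dist x x' = 3 ∧ Γ.Adj v x') := by
  classical
  obtain ⟨m, hpm, hT⟩ := h2gt.exists_hasTaylorParameters hp hreg hconn hnc h2at
  choose α hne hdist hadj using hT.exists_antipode hconn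
  refine ⟨?_, ?_, ?_, ?_, ?_⟩
  · rintro ⟨C⟩
    obtain ⟨u, x, y, hux, huy, hxy⟩ := h2gt.exists_triangle h2at
    have h1 := C.valid hux
    have h2 := C.valid huy
    have h3 := C.valid hxy
    lia
  · obtain ⟨v⟩ := hconn.nonempty
    have huniv : (Finset.univ : Finset V) =
        {v, α v} ∪ (Γ.neighborFinset v ∪ Γ.neighborFinset (α v)) := by
      ext x
      have := hadj v x
      simp only [Finset.mem_univ, Finset.mem_union, Finset.mem_insert, Finset.mem_singleton,
        mem_neighborFinset, true_iff]
      tauto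
    have hdisj : Disjoint (Γ.neighborFinset v) (Γ.neighborFinset (α v)) :=
      Finset.disjoint_left.2 fun x hx hx' => by
        rw [mem_neighborFinset] at hx hx'
        exact ((hadj v x).1 hx').2.2 hx
    have hnot : ¬ Γ.Adj v (α v) := fun h' => ((hadj v v).1
      ((Γ.adj_comm _ _).1 h')).1 rfl
    have hdisj' : Disjoint {v, α v} (Γ.neighborFinset v ∪ Γ.neighborFinset (α v)) := by
      simp [hnot, Γ.adj_comm (α v) v]
    rw [Nat.card_eq_fintype_card, ← Finset.card_univ, huniv, Finset.card_union_of_disjoint hdisj',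
      Finset.card_union_of_disjoint hdisj, Finset.card_pair (hne v), hT.card_neighborFinset,
      hT.card_neighborFinset]
    lia
  · exact fun v => ⟨α v, (hdist v _).2 rfl, fun x hx => (hdist v x).1 hx⟩
  · intro v x x' hxx' hvx hvx'
    obtain rfl := (hdist x x').1 hxx'
    rw [Γ.adj_comm v x, Γ.adj_comm v (α x), hadj x v]
    tauto
  · intro v x hvx hd
    by_cases h : Γ.Adj v x
    · exact .inl h
    · refine .inr ⟨α x, (hdist x _).2 rfl, ((hadj x v).2 ⟨hvx, ?_, fun h' => h h'.symm⟩).symm⟩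
      intro hv
      exact hd (by rw [dist_comm]; exact (hdist x v).2 hv)
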